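/- For every recurrent coloring f : FIN_A ∪ {∅} → C into a finite set C, there exists an infinite block sequence X ⊆ FIN_{A⋆} such that [X]_A is f-homogeneous for color f(∅), i.e., f(p) = f(∅) for every p ∈ [X]_A. -/

import Mathlib

namespace Carlson

/-- The domain of a partial function `ℕ →. B`, encoded as `ℕ → Option B`. -/
def dom {B : Type*} (p : ℕ → Option B) : Set ℕ := {n | p n ≠ none}

/-- `p` is a located word over `B`: a partial function with finite nonempty domain. -/
def IsLW {B : Type*} (p : ℕ → Option B) : Prop := (dom p).Finite ∧ (dom p).Nonempty

/-- A located variable word over `A` is a located word over `Option A`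
(where `none` encodes the variable `⋆`) taking the value `⋆` at least once. -/
def IsLVW {A : Type*} (p : ℕ → Option (Option A)) : Prop :=
  IsLW p ∧ ∃ n, p n = some none

/-- `p < q`: every element of the domain of `p` is below every element of the domain of `q`. -/
def blt {B : Type*} (p q : ℕ → Option B) : Prop :=
  ∀ m ∈ dom p, ∀ n ∈ dom q, m < n

/-- Union `p ∪ q` of two partial functions (`p` takes precedence; for `blt p q`
the domains are disjoint, so this is the genuine union). -/
def pun {B : Type*} (p q : ℕ → Option B) : ℕ → Option B :=
  fun n => (p n).elim (q n) some

/-- The empty partial function. -/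
def emptyW {B : Type*} : ℕ → Option B := fun _ => none

/-- `p[a]`: substitution of the letter `a ∈ A` for the variable `⋆` in a located
variable word. -/
def substA {A : Type*} (p : ℕ → Option (Option A)) (a : A) : ℕ → Option A :=
  fun n => (p n).map fun x => x.getD a

/-- `p[a]` for `a ∈ A ∪ {⋆}` (with `none` encoding `⋆`, so `p[⋆] = p`). -/
def substV {A : Type*} (p : ℕ → Option (Option A)) (a : Option A) : ℕ → Option (Option A) :=
  fun n => (p n).map fun x => x.elim a some

/-- Union of a finite family of partial functions with pairwise disjoint domains. -/
def famUnion {B : Type*} {k : ℕ} (g : Fin k → ℕ → Option B) : ℕ → Option B :=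
  fun n => ((List.ofFn fun i => g i n).filterMap id).head?

/-- A block sequence: a set of located variable words totally ordered by `<`. -/
def IsBlockSeq {A : Type*} (X : Set (ℕ → Option (Option A))) : Prop :=
  (∀ p ∈ X, IsLVW p) ∧ ∀ p ∈ X, ∀ q ∈ X, p = q ∨ blt p q ∨ blt q p

/-- `[X]_A`: located words of the form `p₀[a₀] ∪ ⋯ ∪ p_k[a_k]` with `p₀ < ⋯ < p_k`
all in `X` and `a₀, …, a_k ∈ A`. -/
def combA {A : Type*} (X : Set (ℕ → Option (Option A))) : Set (ℕ → Option A) :=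
  { q | ∃ (k : ℕ) (p : Fin (k + 1) → ℕ → Option (Option A)) (a : Fin (k + 1) → A),
      (∀ i, p i ∈ X) ∧ (∀ i j : Fin (k + 1), i < j → blt (p i) (p j)) ∧
      q = famUnion fun i => substA (p i) (a i) }

/-- `[X]_{A⋆}`: located variable words of the form `p₀[a₀] ∪ ⋯ ∪ p_k[a_k]` with
`p₀ < ⋯ < p_k` all in `X`, `a₀, …, a_k ∈ A ∪ {⋆}`, and `⋆` used at least once. -/
def combV {A : Type*} (X : Set (ℕ → Option (Option A))) : Set (ℕ → Option (Option A)) :=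
  { q | ∃ (k : ℕ) (p : Fin (k + 1) → ℕ → Option (Option A)) (a : Fin (k + 1) → Option A),
      (∀ i, p i ∈ X) ∧ (∀ i j : Fin (k + 1), i < j → blt (p i) (p j)) ∧
      (∃ i, a i = none) ∧ q = famUnion fun i => substV (p i) (a i) }

/-- `X − F`: the elements of `X` whose domain lies entirely above the domains of
all members of `F`. -/
def sminus {B : Type*} (X F : Set (ℕ → Option B)) : Set (ℕ → Option B) :=
  { q ∈ X | ∀ p ∈ F, blt p q }

/-- `dom q ⊆ [0, ℓ)`. -/
def domBelow {B : Type*} (q : ℕ → Option B) (ℓ : ℕ) : Prop := ∀ n ∈ dom q, n < ℓ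

/-- `dom q ⊆ [m, ∞)`. -/
def domAbove {B : Type*} (q : ℕ → Option B) (m : ℕ) : Prop := ∀ n ∈ dom q, m ≤ n

/-- `S^ℓ_p(f) = S^ℓ_{p'}(g)` for colorings of located words: agreement at `q ∪ p`
vs `q ∪ p'` for every located word `q` with domain contained in `[0, ℓ)`.
(Take `p' = emptyW` to express `S^ℓ_p(f) = S^ℓ(g)`.) -/
def SEq {A C : Type*} (f g : (ℕ → Option A) → C) (ℓ : ℕ) (p p' : ℕ → Option A) : Prop :=
  ∀ q : ℕ → Option A, IsLW q → domBelow q ℓ → f (pun q p) = g (pun q p')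

/-- Variant of `SEq` for colorings that are also defined at the empty located word,
i.e. `q` ranges over `FIN_A(0, ℓ) ∪ {∅}`. -/
def SEq0 {A C : Type*} (f g : (ℕ → Option A) → C) (ℓ : ℕ) (p p' : ℕ → Option A) : Prop :=
  ∀ q : ℕ → Option A, (dom q).Finite → domBelow q ℓ → f (pun q p) = g (pun q p')

/-- A coloring `f` is recurrent if for every `ℓ` there is a located variable word `p`
with domain in `[ℓ, ∞)` such that `S^ℓ_{p[a]}(f) = S^ℓ(f)` for every `a ∈ A`. -/
def Recurrent {A C : Type*} (f : (ℕ → Option A) → C) : Prop :=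
  ∀ ℓ : ℕ, ∃ p : ℕ → Option (Option A), IsLVW p ∧ domAbove p ℓ ∧
    ∀ a : A, SEq f f ℓ (substA p a) emptyW

/-- A coloring `f` is uniformly recurrent if for every `ℓ` there is `m > ℓ` such that
for every `p ∈ FIN_A(m, ∞)` there is `q ∈ FIN_A(ℓ, m)` with `S^ℓ_{q ∪ p}(f) = S^ℓ(f)`. -/
def UnifRecurrent {A C : Type*} (f : (ℕ → Option A) → C) : Prop :=
  ∀ ℓ : ℕ, ∃ m : ℕ, ℓ < m ∧ ∀ p : ℕ → Option A, IsLW p → domAbove p m →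
    ∃ q : ℕ → Option A, IsLW q ∧ domAbove q ℓ ∧ domBelow q m ∧
      SEq f f ℓ (pun q p) emptyW

/-- `f` and `g` are weakly proximal: for every `ℓ` there is `p ∈ FIN_A(ℓ, ∞)` with
`S^ℓ_p(f) = S^ℓ_p(g)`. -/
def WeakProx {A C : Type*} (f g : (ℕ → Option A) → C) : Prop :=
  ∀ ℓ : ℕ, ∃ p : ℕ → Option A, IsLW p ∧ domAbove p ℓ ∧ SEq f g ℓ p p

/-- `g` is strongly proximal to `f`: for every `ℓ` there is a located variable word `p`
with domain in `[ℓ, ∞)` such that `S^ℓ(g) = S^ℓ_{p[a]}(g) = S^ℓ_{p[a]}(f)` for all `a ∈ A`. -/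
def StrongProx {A C : Type*} (g f : (ℕ → Option A) → C) : Prop :=
  ∀ ℓ : ℕ, ∃ p : ℕ → Option (Option A), IsLVW p ∧ domAbove p ℓ ∧
    ∀ a : A, SEq g g ℓ emptyW (substA p a) ∧ SEq g f ℓ (substA p a) (substA p a)

/-- `Recurrent` for colorings also defined at the empty located word. -/
def Recurrent0 {A C : Type*} (f : (ℕ → Option A) → C) : Prop :=
  ∀ ℓ : ℕ, ∃ p : ℕ → Option (Option A), IsLVW p ∧ domAbove p ℓ ∧
    ∀ a : A, SEq0 f f ℓ (substA p a) emptyW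

/-- `StrongProx` for colorings also defined at the empty located word. -/
def StrongProx0 {A C : Type*} (g f : (ℕ → Option A) → C) : Prop :=
  ∀ ℓ : ℕ, ∃ p : ℕ → Option (Option A), IsLVW p ∧ domAbove p ℓ ∧
    ∀ a : A, SEq0 g g ℓ emptyW (substA p a) ∧ SEq0 g f ℓ (substA p a) (substA p a)

/-- Agreement of two colorings on all located words with domain in `[0, ℓ)`. -/
def AgreeBelow {A C : Type*} (f g : (ℕ → Option A) → C) (ℓ : ℕ) : Prop :=
  ∀ q : ℕ → Option A, IsLW q → domBelow q ℓ → f q = g q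

/-- Closedness of a class in `C^{FIN_A}` with the product topology (`C` discrete):
a class is closed iff it contains every coloring all of whose finite restrictions
(to located words with domain in `[0, ℓ)`, for each `ℓ`) are matched within the class. -/
def IsClosedColl {A C : Type*} (𝓒 : Set ((ℕ → Option A) → C)) : Prop :=
  ∀ f, (∀ ℓ : ℕ, ∃ g ∈ 𝓒, AgreeBelow f g ℓ) → f ∈ 𝓒

/-- A subshift: a nonempty closed class `𝓒 ⊆ C^{FIN_A}` such that for every `f ∈ 𝓒`,
`ℓ ∈ ℕ` and `p ∈ FIN_A(ℓ, ∞)` there is `g ∈ 𝓒` with `S^ℓ(g) = S^ℓ_p(f)`. -/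
def IsSubshift {A C : Type*} (𝓒 : Set ((ℕ → Option A) → C)) : Prop :=
  𝓒.Nonempty ∧ IsClosedColl 𝓒 ∧
    ∀ f ∈ 𝓒, ∀ ℓ : ℕ, ∀ p : ℕ → Option A, IsLW p → domAbove p ℓ →
      ∃ g ∈ 𝓒, SEq g f ℓ emptyW p

/-- A minimal subshift: no subshift is a proper subset of it. -/
def IsMinimalSubshift {A C : Type*} (𝓒 : Set ((ℕ → Option A) → C)) : Prop :=
  IsSubshift 𝓒 ∧ ∀ 𝓓 : Set ((ℕ → Option A) → C), IsSubshift 𝓓 → 𝓓 ⊆ 𝓒 → 𝓓 = 𝓒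

/-- The orbit closure of a coloring `f`: all `g` such that for every `ℓ` and every
`q ∈ FIN_A(ℓ, ∞)` there is `p ∈ FIN_A(ℓ, ∞)` with `S^ℓ_q(g) = S^ℓ_p(f)`. -/
def orbCl {A C : Type*} (f : (ℕ → Option A) → C) : Set ((ℕ → Option A) → C) :=
  { g | ∀ ℓ : ℕ, ∀ q : ℕ → Option A, IsLW q → domAbove q ℓ →
      ∃ p : ℕ → Option A, IsLW p ∧ domAbove p ℓ ∧ SEq g f ℓ q p }

/-- A variable word over `A`, encoded as a list over `Option A` with `none` = `⋆`:
the variable must occur at least once. -/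
def IsVarWord {A : Type*} (w : List (Option A)) : Prop := none ∈ w

/-- `w[a]`: replace every occurrence of the variable `⋆` by the letter `a`. -/
def substW {A : Type*} (w : List (Option A)) (a : A) : List A :=
  w.map fun x => x.getD a

/-- `⟨(w_n)_{n∈ℕ}⟩_A`: the words `w_{j₀}[a₀] ⋯ w_{j_{k-1}}[a_{k-1}]` extracted from
the sequence `(w_n)`, for `j₀ < ⋯ < j_{k-1}` and letters `a₀, …, a_{k-1} ∈ A`. -/
def extracted {A : Type*} (w : ℕ → List (Option A)) : Set (List A) :=
  { u | ∃ (k : ℕ) (j : Fin (k + 1) → ℕ) (a : Fin (k + 1) → A),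
      StrictMono j ∧ u = (List.ofFn fun i => substW (w (j i)) (a i)).flatten }

theorem famUnion_zero {B : Type*} (g : Fin 0 → ℕ → Option B) : famUnion g = emptyW := by
  funext n
  simp [famUnion, emptyW]

theorem famUnion_succ {B : Type*} {k : ℕ} (g : Fin (k + 1) → ℕ → Option B) :
    famUnion g = pun (famUnion fun i => g i.castSucc) (g (Fin.last k)) := by
  funext n
  simp only [famUnion, pun, List.ofFn_succ', List.concat_eq_append, List.filterMap_append,
    List.head?_append]
  cases ((List.ofFn fun i : Fin k => g i.castSucc n).filterMap id).head? <;>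
    cases g (Fin.last k) n <;> simp

theorem pun_emptyW {B : Type*} (p : ℕ → Option B) : pun p emptyW = p := by
  funext n
  cases h : p n <;> simp [pun, emptyW, h]

theorem dom_pun {B : Type*} (p q : ℕ → Option B) : dom (pun p q) = dom p ∪ dom q := by
  ext n
  cases h : p n <;> simp [dom, pun, h]

theorem dom_emptyW {B : Type*} : dom (emptyW : ℕ → Option B) = ∅ := by
  simp [dom, emptyW]

theorem dom_famUnion {B : Type*} {k : ℕ} (g : Fin k → ℕ → Option B) :
    dom (famUnion g) = ⋃ i, dom (g i) := by
  induction k with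
  | zero => simp [famUnion_zero, dom_emptyW]
  | succ k ih =>
    ext n
    simp [famUnion_succ, dom_pun, ih, Fin.exists_fin_succ']

theorem dom_substA {A : Type*} (p : ℕ → Option (Option A)) (a : A) :
    dom (substA p a) = dom p := by
  ext n
  simp [dom, substA]

theorem not_blt_self {B : Type*} {p : ℕ → Option B} (hp : (dom p).Nonempty) : ¬ blt p p :=
  fun h => hp.elim fun n hn => lt_irrefl n (h n hn n hn)

theorem blt_asymm {B : Type*} {p q : ℕ → Option B} (hp : (dom p).Nonempty)
    (hq : (dom q).Nonempty) (h : blt p q) : ¬ blt q p := by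
  obtain ⟨m, hm⟩ := hp
  obtain ⟨n, hn⟩ := hq
  exact fun h' => lt_asymm (h m hm n hn) (h' n hn m hm)

theorem exists_domBelow {B : Type*} {p : ℕ → Option B} (hp : (dom p).Finite) :
    ∃ ℓ, domBelow p ℓ := by
  obtain ⟨b, hb⟩ := hp.bddAbove
  exact ⟨b + 1, fun n hn => Nat.lt_succ_of_le (hb hn)⟩

/-- If each member of a sequence of variable words leaves `f` unchanged over everything lying
below its own domain threshold, then all combinations of the sequence have the color `f ∅`. -/
theorem eq_emptyW_of_famUnion {A C : Type*} {f : (ℕ → Option A) → C}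
    {w : ℕ → ℕ → Option (Option A)} {L : ℕ → ℕ} (hfin : ∀ n, (dom (w n)).Finite)
    (hf : ∀ n a, SEq0 f f (L n) (substA (w n) a) emptyW)
    (hbelow : ∀ m n, blt (w m) (w n) → domBelow (w m) (L n))
    {k : ℕ} (p : Fin k → ℕ → Option (Option A)) (a : Fin k → A)
    (hp : ∀ i, p i ∈ Set.range w) (hlt : ∀ i j, i < j → blt (p i) (p j)) :
    f (famUnion fun i => substA (p i) (a i)) = f emptyW := by
  induction k with
  | zero => rw [famUnion_zero]
  | succ k ih =>
    choose s hs using hp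
    obtain rfl : (fun i => w (s i)) = p := funext hs
    rw [famUnion_succ, hf, pun_emptyW]
    · exact ih _ _ (fun i => ⟨_, rfl⟩) fun i j h => hlt _ _ (Fin.castSucc_lt_castSucc_iff.2 h)
    · rw [dom_famUnion]
      exact Set.finite_iUnion fun i => by simpa only [dom_substA] using hfin _
    · intro n hn
      simp only [dom_famUnion, dom_substA, Set.mem_iUnion] at hn
      obtain ⟨i, hi⟩ := hn
      exact hbelow _ _ (hlt _ _ (Fin.castSucc_lt_last i)) n hi

/-- For every recurrent coloring `f : FIN_A ∪ {∅} → C` there is an infinite block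
sequence `X ⊆ FIN_{A⋆}` such that `[X]_A` is `f`-homogeneous for color `f(∅)`. -/
theorem recurrent_yields_homogeneous {A C : Type*} [Fintype A] [Nonempty A] [Fintype C]
    (f : (ℕ → Option A) → C) (hf : Recurrent0 f) :
    ∃ X : Set (ℕ → Option (Option A)), IsBlockSeq X ∧ X.Infinite ∧
      ∀ q ∈ combA X, f q = f emptyW := by
  choose v hv habove hf using hf
  choose b hb using fun ℓ => exists_domBelow (hv ℓ).1.1
  let L : ℕ → ℕ := fun n => b^[n] 0
  have L_succ : ∀ n, L (n + 1) = b (L n) := fun n => Function.iterate_succ_apply' b n 0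
  have L_mono : Monotone L := monotone_nat_of_le_succ fun n => by
    obtain ⟨x, hx⟩ := (hv (L n)).1.2
    rw [L_succ]
    exact (habove _ x hx).trans (hb _ x hx).le
  let w : ℕ → ℕ → Option (Option A) := fun n => v (L n)
  have hne : ∀ n, (dom (w n)).Nonempty := fun n => (hv _).1.2
  have w_below : ∀ {m n}, m < n → domBelow (w m) (L n) := fun {m n} h x hx =>
    ((hb _ x hx).trans_eq (L_succ m).symm).trans_le (L_mono h)
  have w_blt : ∀ {m n}, m < n → blt (w m) (w n) := fun h x hx y hy =>
    (w_below h x hx).trans_le (habove _ y hy)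
  have lt_of_blt : ∀ {m n}, blt (w m) (w n) → m < n := by
    intro m n h
    by_contra! hle
    obtain rfl | hlt := hle.eq_or_lt
    · exact not_blt_self (hne _) h
    · exact blt_asymm (hne _) (hne _) h (w_blt hlt)
  have w_inj : Function.Injective w := .of_lt_imp_ne fun m n h e => by
    have h' := w_blt h
    rw [e] at h'
    exact not_blt_self (hne n) h'
  refine ⟨Set.range w, ⟨?_, ?_⟩, Set.infinite_range_of_injective w_inj, ?_⟩
  · rintro _ ⟨n, rfl⟩
    exact hv _
  · rintro _ ⟨m, rfl⟩ _ ⟨n, rfl⟩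
    obtain h | rfl | h := lt_trichotomy m n
    · exact Or.inr (Or.inl (w_blt h))
    · exact Or.inl rfl
    · exact Or.inr (Or.inr (w_blt h))
  · rintro _ ⟨k, p, a, hp, hlt, rfl⟩
    exact eq_emptyW_of_famUnion (fun n => (hv _).1.1) (fun n => hf (L n))
      (fun m n h => w_below (lt_of_blt h)) p a hp hlt

end Carlson
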